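/- arXiv:1705.07258 — 9 statements merged into one kernel-verified Lean document; each statement's English description precedes it below -/
import Mathlib

section
/- Let A and B be finite subsets of a type, with A ∪ B nonempty, let x ∉ A, and set A' = A ∪ {x}. If n is a positive natural number with n ≤ |A ∪ B|, then |J(A,B) − J(A',B)| ≤ 1/n, where J denotes the Jaccard similarity. -/
/-- The Jaccard similarity of two finite sets, as a real number. -/
noncomputable def jaccard {α : Type*} [DecidableEq α] (S T : Finset α) : ℝ :=
  ((S ∩ T).card : ℝ) / ((S ∪ T).card : ℝ)

/-- Adding a single new element `x` to `A` changes the Jaccard similarity with `B`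
by at most `1 / n`, for any positive `n ≤ |A ∪ B|`. -/
theorem jaccard_insert_diff_le {α : Type*} [DecidableEq α]
    (A B : Finset α) (x : α) (hx : x ∉ A) (hAB : (A ∪ B).Nonempty)
    (n : ℕ) (hn : 0 < n) (hcard : n ≤ (A ∪ B).card) :
    |jaccard A B - jaccard (insert x A) B| ≤ 1 / (n : ℝ) := by
  have hu : 0 < (A ∪ B).card := hAB.card_pos
  have hnR : (0 : ℝ) < n := by exact_mod_cast hn
  have huR : (0 : ℝ) < ((A ∪ B).card : ℝ) := by exact_mod_cast hu
  have hcR : (n : ℝ) ≤ ((A ∪ B).card : ℝ) := by exact_mod_cast hcard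
  have hiu : ((A ∩ B).card : ℝ) ≤ ((A ∪ B).card : ℝ) := by
    exact_mod_cast Finset.card_le_card
      (Finset.inter_subset_left.trans Finset.subset_union_left)
  refine le_trans ?_ (one_div_le_one_div_of_le hnR hcR)
  unfold jaccard
  by_cases hB : x ∈ B
  · have h1 : insert x A ∪ B = A ∪ B := by
      rw [Finset.insert_union, Finset.insert_eq_self]
      exact Finset.mem_union_right _ hB
    have h2 : (insert x A ∩ B).card = (A ∩ B).card + 1 := by
      rw [Finset.insert_inter_of_mem hB, Finset.card_insert_of_notMem]
      exact fun h => hx (Finset.mem_inter.mp h).1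
    rw [h1, h2, ← sub_div, abs_div, abs_of_pos huR]
    push_cast
    simp
  · have h1 : (insert x A ∪ B).card = (A ∪ B).card + 1 := by
      rw [Finset.insert_union, Finset.card_insert_of_notMem]
      simp [hx, hB]
    rw [h1, Finset.insert_inter_of_notMem hB]
    push_cast
    generalize ((A ∪ B).card : ℝ) = u at *
    have hi : (0 : ℝ) ≤ ((A ∩ B).card : ℝ) := Nat.cast_nonneg _
    generalize ((A ∩ B).card : ℝ) = i at *
    have h3 : i / u - i / (u + 1) = (i / (u + 1)) * (1 / u) := by
      field_simp
      ring
    have h4 : i / (u + 1) ≤ 1 := by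
      rw [div_le_one (by linarith)]
      linarith
    rw [h3, abs_of_nonneg (by positivity)]
    exact mul_le_of_le_one_left (by positivity) h4
end

section
/- Let U be a nonempty finite linear order and let A, B be nonempty finite subsets of U. If π is a permutation of U drawn uniformly at random from all permutations of U, then the probability that the minimum of the image π(A) equals the minimum of the image π(B) is exactly J(A,B) = |A ∩ B| / |A ∪ B|. -/
open scoped ENNReal

/-- We put the trivial (discrete) measurable structure on permutation groups. -/
instance {α : Type*} : MeasurableSpace (Equiv.Perm α) := ⊤

/-- The element of `C` whose image under `π` is minimal. -/
noncomputable def argMinPerm {U : Type*} [LinearOrder U]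
    (C : Finset U) (hC : C.Nonempty) (π : Equiv.Perm U) : U :=
  π.symm ((C.image π).min' (hC.image π))

theorem apply_argMinPerm {U : Type*} [LinearOrder U]
    (C : Finset U) (hC : C.Nonempty) (π : Equiv.Perm U) :
    π (argMinPerm C hC π) = (C.image π).min' (hC.image π) := by
  simp [argMinPerm]

theorem argMinPerm_mem {U : Type*} [LinearOrder U]
    (C : Finset U) (hC : C.Nonempty) (π : Equiv.Perm U) : argMinPerm C hC π ∈ C := by
  have h := Finset.min'_mem (C.image π) (hC.image π)
  rw [← apply_argMinPerm C hC, Finset.mem_image] at h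
  obtain ⟨a, ha, h⟩ := h
  rwa [← π.injective h]

theorem argMinPerm_le {U : Type*} [LinearOrder U]
    (C : Finset U) (hC : C.Nonempty) (π : Equiv.Perm U) {y : U} (hy : y ∈ C) :
    π (argMinPerm C hC π) ≤ π y := by
  rw [apply_argMinPerm]
  exact Finset.min'_le _ _ (Finset.mem_image_of_mem _ hy)

theorem argMinPerm_eq {U : Type*} [LinearOrder U]
    (C : Finset U) (hC : C.Nonempty) (π : Equiv.Perm U) {x : U} (hx : x ∈ C)
    (h : ∀ y ∈ C, π x ≤ π y) : argMinPerm C hC π = x :=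
  π.injective (le_antisymm (argMinPerm_le C hC π hx) (h _ (argMinPerm_mem C hC π)))

theorem argMinPerm_mul_swap {U : Type*} [LinearOrder U]
    (C : Finset U) (hC : C.Nonempty) (π : Equiv.Perm U) {x y : U} (hx : x ∈ C) (hy : y ∈ C)
    (h : argMinPerm C hC π = x) : argMinPerm C hC (π * Equiv.swap x y) = y := by
  apply argMinPerm_eq _ _ _ hy
  intro z hz
  have hs : Equiv.swap x y z ∈ C := by
    rw [Equiv.swap_apply_def]
    split_ifs <;> assumption
  have := argMinPerm_le C hC π hs
  rw [h] at this
  simpa using this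

theorem card_fiber_eq {U : Type*} [Fintype U] [LinearOrder U]
    (C : Finset U) (hC : C.Nonempty) {x y : U} (hx : x ∈ C) (hy : y ∈ C) :
    (Finset.univ.filter fun π : Equiv.Perm U => argMinPerm C hC π = x).card =
    (Finset.univ.filter fun π : Equiv.Perm U => argMinPerm C hC π = y).card := by
  apply Finset.card_bij' (fun π _ => π * Equiv.swap x y) (fun π _ => π * Equiv.swap x y)
  · intro π h
    simp only [Finset.mem_filter, Finset.mem_univ, true_and] at h ⊢
    exact argMinPerm_mul_swap C hC π hx hy h
  · intro π h
    simp only [Finset.mem_filter, Finset.mem_univ, true_and] at h ⊢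
    rw [Equiv.swap_comm]
    exact argMinPerm_mul_swap C hC π hy hx h
  · intro π _
    simp [mul_assoc]
  · intro π _
    simp [mul_assoc]

theorem card_argMinPerm_mem {U : Type*} [Fintype U] [LinearOrder U]
    (C : Finset U) (hC : C.Nonempty) {x : U} (hx : x ∈ C) (D : Finset U) (hD : D ⊆ C) :
    (Finset.univ.filter fun π : Equiv.Perm U => argMinPerm C hC π ∈ D).card =
    D.card * (Finset.univ.filter fun π : Equiv.Perm U => argMinPerm C hC π = x).card := by
  rw [Finset.card_eq_sum_card_fiberwise (f := argMinPerm C hC) (t := D)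
    (by intro π h; simpa using h), ← smul_eq_mul]
  apply Finset.sum_eq_card_nsmul
  intro y hy
  rw [card_fiber_eq C hC hx (hD hy), Finset.filter_filter]
  congr 1
  ext π
  simp only [Finset.mem_filter, Finset.mem_univ, true_and]
  exact ⟨fun h => h.2, fun h => ⟨h ▸ hy, h⟩⟩

theorem min_image_eq_iff {U : Type*} [LinearOrder U]
    (A B : Finset U) (hA : A.Nonempty) (hB : B.Nonempty) (hC : (A ∪ B).Nonempty)
    (π : Equiv.Perm U) :
    (A.image π).min' (hA.image π) = (B.image π).min' (hB.image π) ↔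
      argMinPerm (A ∪ B) hC π ∈ A ∩ B := by
  rw [← apply_argMinPerm A hA, ← apply_argMinPerm B hB, π.injective.eq_iff]
  constructor
  · intro h
    have ha := argMinPerm_mem A hA π
    have hb := argMinPerm_mem B hB π
    rw [← h] at hb
    rw [argMinPerm_eq (A ∪ B) hC π (Finset.mem_union_left _ ha)]
    · exact Finset.mem_inter.2 ⟨ha, hb⟩
    · intro y hy
      rcases Finset.mem_union.1 hy with hy | hy
      · exact argMinPerm_le A hA π hy
      · rw [h]
        exact argMinPerm_le B hB π hy
  · intro h
    rw [Finset.mem_inter] at h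
    rw [argMinPerm_eq A hA π h.1 fun y hy => argMinPerm_le _ hC π (Finset.mem_union_left _ hy),
      argMinPerm_eq B hB π h.2 fun y hy => argMinPerm_le _ hC π (Finset.mem_union_right _ hy)]

/-- The MinHash property: for a uniformly random permutation `π` of a finite linear order,
the probability that `min π(A) = min π(B)` is exactly the Jaccard similarity of `A` and `B`. -/
theorem prob_min_image_eq_jaccard {U : Type*} [Fintype U] [LinearOrder U] [Nonempty U]
    (A B : Finset U) (hA : A.Nonempty) (hB : B.Nonempty) :
    (PMF.uniformOfFintype (Equiv.Perm U)).toMeasure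
      {π : Equiv.Perm U |
        (A.image π).min' (hA.image π) = (B.image π).min' (hB.image π)}
      = ENNReal.ofReal (jaccard A B) := by
  classical
  have hC : (A ∪ B).Nonempty := hA.mono Finset.subset_union_left
  obtain ⟨x, hx⟩ := id hC
  have h1 := card_argMinPerm_mem (A ∪ B) hC hx (A ∩ B)
    (Finset.inter_subset_left.trans Finset.subset_union_left)
  have h2 := card_argMinPerm_mem (A ∪ B) hC hx (A ∪ B) (Finset.Subset.refl _)
  rw [Finset.filter_true_of_mem (fun π _ => argMinPerm_mem _ hC π), Finset.card_univ] at h2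
  rw [PMF.toMeasure_uniformOfFintype_apply _ MeasurableSpace.measurableSet_top]
  simp only [min_image_eq_iff A B hA hB hC]
  rw [Fintype.card_subtype]
  simp only [Set.mem_setOf_eq]
  rw [h1, h2, jaccard,
    ENNReal.ofReal_div_of_pos (by exact_mod_cast hC.card_pos), ENNReal.ofReal_natCast,
    ENNReal.ofReal_natCast]
  push_cast
  refine ENNReal.mul_div_mul_right _ _ ?_ (ENNReal.natCast_ne_top _)
  intro h0
  rw [Nat.cast_eq_zero] at h0
  rw [h0, mul_zero] at h2
  exact Fintype.card_ne_zero h2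
end

section
/- Let U be a nonempty finite linear order, let A, B be nonempty finite subsets of U, and let π₁, …, π_K be K ≥ 1 independent permutations of U, each uniformly distributed. Then the expectation of the estimator J_mh = (1/K) · #{k ∈ {1,…,K} : min π_k(A) = min π_k(B)} equals J(A,B) = |A ∩ B| / |A ∪ B|; that is, J_mh is an unbiased estimator of the Jaccard similarity. -/
open scoped ENNReal

/-- The MinHash estimator built from the `K` permutations `πs 0, …, πs (K-1)`:
the fraction of indices `k` on which the minima of the images of `A` and `B` agree. -/
noncomputable def minHashEstimator {U : Type*} [Fintype U] [LinearOrder U]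
    {A B : Finset U} (hA : A.Nonempty) (hB : B.Nonempty) (K : ℕ)
    (πs : Fin K → Equiv.Perm U) : ℝ :=
  ((Finset.univ.filter fun k : Fin K =>
      (A.image (πs k)).min' (hA.image (πs k)) =
        (B.image (πs k)).min' (hB.image (πs k))).card : ℝ) / (K : ℝ)

/-- The tuples for which the minimum of the `k`-th permutation on `S` is attained at `u`. -/
noncomputable def minAtSet {U : Type*} [Fintype U] [LinearOrder U] (S : Finset U) (K : ℕ)
    (k : Fin K) (u : U) : Finset (Fin K → Equiv.Perm U) :=
  Finset.univ.filter fun p => ∀ v ∈ S, p k u ≤ p k v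

lemma minAtSet_card_le {U : Type*} [Fintype U] [LinearOrder U] (S : Finset U) (K : ℕ)
    (k : Fin K) (u w : U) (hu : u ∈ S) (hw : w ∈ S) :
    (minAtSet S K k u).card ≤ (minAtSet S K k w).card := by
  apply Finset.card_le_card_of_injOn (fun p j => p j * Equiv.swap u w)
  · intro p hp
    simp only [minAtSet, Finset.coe_filter, Finset.mem_univ, true_and, Set.mem_ofPred_eq,
      Equiv.Perm.mul_apply, Equiv.swap_apply_right] at hp ⊢
    intro v hv
    apply hp
    rw [Equiv.swap_apply_def]
    split_ifs <;> assumption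
  · intro p _ q _ h
    funext j
    exact mul_right_cancel (congrFun h j)

lemma minAtSet_disjoint {U : Type*} [Fintype U] [LinearOrder U] (S T : Finset U) (hT : T ⊆ S)
    (K : ℕ) (k : Fin K) : (T : Set U).PairwiseDisjoint (minAtSet S K k) := by
  intro u hu w hw huw
  rw [Function.onFun, Finset.disjoint_left]
  intro p hp hq
  simp only [minAtSet, Finset.mem_filter, Finset.mem_univ, true_and] at hp hq
  exact huw ((p k).injective (le_antisymm (hp w (hT hw)) (hq u (hT hu))))

lemma minAtSet_univ {U : Type*} [Fintype U] [LinearOrder U] (S : Finset U) (hS : S.Nonempty)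
    (K : ℕ) (k : Fin K) : S.biUnion (minAtSet S K k) = Finset.univ := by
  ext p
  simp only [Finset.mem_biUnion, minAtSet, Finset.mem_filter, Finset.mem_univ, true_and, iff_true]
  exact Finset.exists_min_image S (p k) hS

lemma minAtSet_inter {U : Type*} [Fintype U] [LinearOrder U] {A B : Finset U}
    (hA : A.Nonempty) (hB : B.Nonempty) (K : ℕ) (k : Fin K) :
    (A ∩ B).biUnion (minAtSet (A ∪ B) K k) = Finset.univ.filter fun p : Fin K → Equiv.Perm U =>
      (A.image (p k)).min' (hA.image (p k)) = (B.image (p k)).min' (hB.image (p k)) := by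
  ext p
  simp only [Finset.mem_biUnion, minAtSet, Finset.mem_filter, Finset.mem_univ, true_and]
  have key : ∀ (C : Finset U) (hC : C.Nonempty) (u : U), u ∈ C → (∀ v ∈ C, p k u ≤ p k v) →
      (C.image (p k)).min' (hC.image (p k)) = p k u := by
    intro C hC u hu h
    apply le_antisymm
    · exact Finset.min'_le _ _ (Finset.mem_image_of_mem _ hu)
    · apply Finset.le_min'
      intro y hy
      obtain ⟨v, hv, rfl⟩ := Finset.mem_image.1 hy
      exact h v hv
  constructor
  · rintro ⟨u, hu, h⟩
    rw [Finset.mem_inter] at hu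
    rw [key A hA u hu.1 fun v hv => h v (Finset.mem_union_left _ hv),
      key B hB u hu.2 fun v hv => h v (Finset.mem_union_right _ hv)]
  · intro h
    obtain ⟨a, ha, ha'⟩ := Finset.exists_min_image A (p k) hA
    obtain ⟨b, hb, hb'⟩ := Finset.exists_min_image B (p k) hB
    rw [key A hA a ha ha', key B hB b hb hb'] at h
    obtain rfl := (p k).injective h
    refine ⟨a, Finset.mem_inter.2 ⟨ha, hb⟩, fun v hv => ?_⟩
    rcases Finset.mem_union.1 hv with hv | hv
    · exact ha' v hv
    · exact hb' v hv

lemma minHash_card {U : Type*} [Fintype U] [LinearOrder U] {A B : Finset U}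
    (hA : A.Nonempty) (hB : B.Nonempty) (K : ℕ) (k : Fin K) :
    (((Finset.univ.filter fun p : Fin K → Equiv.Perm U =>
      (A.image (p k)).min' (hA.image (p k)) = (B.image (p k)).min' (hB.image (p k))).card : ℕ) : ℝ)
      = Fintype.card (Fin K → Equiv.Perm U) * jaccard A B := by
  obtain ⟨a, ha⟩ := hA
  have ha' : a ∈ A ∪ B := Finset.mem_union_left _ ha
  have hsub : A ∩ B ⊆ A ∪ B := Finset.inter_subset_left.trans Finset.subset_union_left
  have hc : ∀ u ∈ A ∪ B, (minAtSet (A ∪ B) K k u).card = (minAtSet (A ∪ B) K k a).card :=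
    fun u hu => le_antisymm (minAtSet_card_le _ K k u a hu ha') (minAtSet_card_le _ K k a u ha' hu)
  rw [← minAtSet_inter ⟨a, ha⟩ hB K k, Finset.card_biUnion (minAtSet_disjoint _ _ hsub K k),
    Finset.sum_congr rfl fun u hu => hc u (hsub hu), ← Finset.card_univ,
    ← minAtSet_univ (A ∪ B) ⟨a, ha'⟩ K k,
    Finset.card_biUnion (minAtSet_disjoint _ _ subset_rfl K k), Finset.sum_congr rfl hc]
  have h0 : ((A ∪ B).card : ℝ) ≠ 0 := by
    exact_mod_cast (Finset.card_pos.2 ⟨a, ha'⟩).ne'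
  simp only [Finset.sum_const, smul_eq_mul, Nat.cast_mul, jaccard]
  field_simp

/-- The MinHash estimator with `K ≥ 1` independent uniformly random permutations
is an unbiased estimator of the Jaccard similarity: its expectation (under the
`K`-fold product of the uniform distribution on permutations, i.e. the uniform
distribution on tuples of permutations) equals `J(A,B)`. -/
theorem expectation_minHashEstimator {U : Type*} [Fintype U] [LinearOrder U] [Nonempty U]
    (A B : Finset U) (hA : A.Nonempty) (hB : B.Nonempty) (K : ℕ) (hK : 1 ≤ K) :
    ∫ πs : Fin K → Equiv.Perm U, minHashEstimator hA hB K πs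
        ∂(PMF.uniformOfFintype (Fin K → Equiv.Perm U)).toMeasure
      = jaccard A B := by
  have hK' : (K : ℝ) ≠ 0 := by exact_mod_cast (by omega : K ≠ 0)
  have : MeasurableSingletonClass (Equiv.Perm U) := ⟨fun _ => trivial⟩
  have hN : (Fintype.card (Fin K → Equiv.Perm U) : ℝ) ≠ 0 := by
    exact_mod_cast Fintype.card_ne_zero
  have hsum : ∑ p : Fin K → Equiv.Perm U, minHashEstimator hA hB K p
      = Fintype.card (Fin K → Equiv.Perm U) * jaccard A B := by
    simp only [minHashEstimator]
    rw [← Finset.sum_div, div_eq_iff hK']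
    simp only [Finset.card_filter, Nat.cast_sum]
    rw [Finset.sum_comm]
    simp only [← Nat.cast_sum, ← Finset.card_filter]
    rw [Nat.cast_sum, Finset.sum_congr rfl fun k _ => minHash_card hA hB K k]
    simp only [Finset.sum_const, Finset.card_univ, Fintype.card_fin, nsmul_eq_mul]
    ring
  rw [PMF.integral_eq_sum]
  simp only [PMF.uniformOfFintype_apply, smul_eq_mul]
  rw [← Finset.mul_sum, hsum, ENNReal.toReal_inv, ENNReal.toReal_natCast]
  field_simp
end

section
/- Let U be a nonempty finite linear order, let A, B be nonempty finite subsets of U with σ = J(A,B), and let π₁, …, π_K be K ≥ 1 independent uniformly distributed permutations of U. Then the variance of the estimator J_mh = (1/K) · #{k : min π_k(A) = min π_k(B)} equals σ(1−σ)/K, and in particular is at most 1/(4K); hence the standard deviation of J_mh is at most 1/(2√K), i.e., the expected error of the MinHash estimate is O(1/√K). -/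
open scoped ENNReal

open MeasureTheory ProbabilityTheory

/-- The element of `W` whose image under `π` is smallest. -/
noncomputable def mhArg {U : Type*} [LinearOrder U] {W : Finset U} (hW : W.Nonempty)
    (π : Equiv.Perm U) : U := π.symm ((W.image π).min' (hW.image π))

lemma mhArg_mem {U : Type*} [LinearOrder U] {W : Finset U} (hW : W.Nonempty)
    (π : Equiv.Perm U) : mhArg hW π ∈ W := by
  have h := (W.image π).min'_mem (hW.image π)
  obtain ⟨a, ha, e⟩ := Finset.mem_image.1 h
  rw [mhArg, ← e]
  simpa using ha

lemma mhArg_le {U : Type*} [LinearOrder U] {W : Finset U} (hW : W.Nonempty)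
    (π : Equiv.Perm U) {x : U} (hx : x ∈ W) : π (mhArg hW π) ≤ π x := by
  rw [mhArg, Equiv.apply_symm_apply]
  exact Finset.min'_le _ _ (Finset.mem_image_of_mem _ hx)

lemma mhArg_eq {U : Type*} [LinearOrder U] {W : Finset U} (hW : W.Nonempty)
    (π : Equiv.Perm U) {w : U} (hw : w ∈ W) (h : ∀ x ∈ W, π w ≤ π x) : mhArg hW π = w :=
  π.injective (le_antisymm (mhArg_le hW π hw) (h _ (mhArg_mem hW π)))

lemma mh_event_iff {U : Type*} [LinearOrder U] {A B : Finset U} (hA : A.Nonempty)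
    (hB : B.Nonempty) (hW : (A ∪ B).Nonempty) (π : Equiv.Perm U) :
    (A.image π).min' (hA.image π) = (B.image π).min' (hB.image π) ↔
      mhArg hW π ∈ A ∩ B := by
  have e1 : (A.image π).min' (hA.image π) = π (mhArg hA π) := by simp [mhArg]
  have e2 : (B.image π).min' (hB.image π) = π (mhArg hB π) := by simp [mhArg]
  rw [e1, e2, π.injective.eq_iff]
  constructor
  · intro h
    have : mhArg hW π = mhArg hA π := by
      apply mhArg_eq
      · exact Finset.mem_union_left _ (mhArg_mem hA π)
      · intro x hx
        rcases Finset.mem_union.1 hx with hx | hx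
        · exact mhArg_le hA π hx
        · rw [h]; exact mhArg_le hB π hx
    rw [this]
    exact Finset.mem_inter.2 ⟨mhArg_mem hA π, h ▸ mhArg_mem hB π⟩
  · intro h
    have h' := Finset.mem_inter.1 h
    rw [mhArg_eq hA π h'.1 fun x hx => mhArg_le hW π (Finset.mem_union_left _ hx),
      mhArg_eq hB π h'.2 fun x hx => mhArg_le hW π (Finset.mem_union_right _ hx)]

lemma mhArg_fiber {U : Type*} [Fintype U] [LinearOrder U] {W : Finset U} (hW : W.Nonempty)
    {v w : U} (hv : v ∈ W) (hw : w ∈ W) :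
    (Finset.univ.filter fun π : Equiv.Perm U => mhArg hW π = v).card ≤
      (Finset.univ.filter fun π : Equiv.Perm U => mhArg hW π = w).card := by
  apply Finset.card_le_card_of_injOn (fun π => π * Equiv.swap v w)
  · intro π hπ
    simp only [Finset.coe_filter, Finset.mem_univ, true_and, Set.mem_setOf_eq] at hπ ⊢
    apply mhArg_eq hW _ hw
    intro x hx
    simp only [Equiv.Perm.mul_apply, Equiv.swap_apply_right]
    rw [← hπ]
    apply mhArg_le
    rw [hπ, Equiv.swap_apply_def]
    split_ifs <;> assumption
  · intro a _ b _ h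
    exact mul_right_cancel h

lemma mh_count {U : Type*} [Fintype U] [LinearOrder U] {A B : Finset U} (hA : A.Nonempty)
    (hB : B.Nonempty) :
    ((Finset.univ.filter fun π : Equiv.Perm U =>
      (A.image π).min' (hA.image π) = (B.image π).min' (hB.image π)).card : ℝ) =
      jaccard A B * Fintype.card (Equiv.Perm U) := by
  have hW : (A ∪ B).Nonempty := hA.mono Finset.subset_union_left
  obtain ⟨w, hw⟩ := id hW
  set n := (Finset.univ.filter fun π : Equiv.Perm U => mhArg hW π = w).card with hn
  have hf : ∀ v ∈ A ∪ B,
      (Finset.univ.filter fun π : Equiv.Perm U => mhArg hW π = v).card = n := fun v hv =>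
    le_antisymm (mhArg_fiber hW hv hw) (mhArg_fiber hW hw hv)
  have h1 : Fintype.card (Equiv.Perm U) = (A ∪ B).card * n := by
    rw [← Finset.card_univ, Finset.card_eq_sum_card_fiberwise (f := mhArg hW) (t := A ∪ B)
      (fun π _ => mhArg_mem hW π), Finset.sum_congr rfl hf, Finset.sum_const, smul_eq_mul]
  have h2 : (Finset.univ.filter fun π : Equiv.Perm U =>
      (A.image π).min' (hA.image π) = (B.image π).min' (hB.image π)).card
      = (A ∩ B).card * n := by
    simp only [mh_event_iff hA hB hW]
    rw [Finset.card_eq_sum_card_fiberwise (f := mhArg hW) (t := A ∩ B)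
      (fun π hπ => by simpa using hπ)]
    rw [← smul_eq_mul, ← Finset.sum_const]
    apply Finset.sum_congr rfl
    intro v hv
    rw [← hf v (Finset.mem_union_left _ (Finset.mem_inter.1 hv).1), Finset.filter_filter]
    congr 1
    ext π
    simp only [Finset.mem_filter, Finset.mem_univ, true_and, and_iff_right_iff_imp]
    intro h; rw [h]; exact hv
  have hpos : ((A ∪ B).card : ℝ) ≠ 0 := by exact_mod_cast hW.card_pos.ne'
  rw [h1, h2, jaccard]
  push_cast
  field_simp

/-- The indicator of a collision. -/
noncomputable def mhInd {U : Type*} [LinearOrder U] {A B : Finset U} (hA : A.Nonempty)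
    (hB : B.Nonempty) (π : Equiv.Perm U) : ℝ :=
  if (A.image π).min' (hA.image π) = (B.image π).min' (hB.image π) then 1 else 0

lemma mh_pi {α : Type*} [Fintype α] [Nonempty α] [MeasurableSpace α]
    [MeasurableSingletonClass α] (K : ℕ) :
    (PMF.uniformOfFintype (Fin K → α)).toMeasure =
      Measure.pi fun _ : Fin K => (PMF.uniformOfFintype α).toMeasure := by
  classical
  apply Measure.ext_of_singleton
  intro f
  rw [Measure.pi_singleton, PMF.toMeasure_apply_singleton _ _ (measurableSet_singleton f)]
  simp [PMF.toMeasure_apply_singleton, PMF.uniformOfFintype_apply, ENNReal.inv_pow]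

instance mhDiscrete {α : Type*} : DiscreteMeasurableSpace (Equiv.Perm α) :=
  ⟨fun _ => trivial⟩

lemma mh_integral {U : Type*} [Fintype U] [LinearOrder U] {A B : Finset U} (hA : A.Nonempty)
    (hB : B.Nonempty) :
    ∫ π, mhInd hA hB π ∂(PMF.uniformOfFintype (Equiv.Perm U)).toMeasure = jaccard A B := by
  rw [PMF.integral_eq_sum]
  simp only [PMF.uniformOfFintype_apply, smul_eq_mul, ← Finset.mul_sum, mhInd,
    Finset.sum_boole]
  have : (Fintype.card (Equiv.Perm U) : ℝ) ≠ 0 := by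
    exact_mod_cast Fintype.card_ne_zero
  rw [ENNReal.toReal_inv, ENNReal.toReal_natCast]
  field_simp
  rw [mul_comm, ← mh_count hA hB]

lemma mh_memLp {U : Type*} [Fintype U] [LinearOrder U] {A B : Finset U} (hA : A.Nonempty)
    (hB : B.Nonempty) :
    MemLp (mhInd hA hB) 2 (PMF.uniformOfFintype (Equiv.Perm U)).toMeasure := by
  exact MemLp.of_discrete

lemma mh_var {U : Type*} [Fintype U] [LinearOrder U] {A B : Finset U} (hA : A.Nonempty)
    (hB : B.Nonempty) :
    variance (mhInd hA hB) (PMF.uniformOfFintype (Equiv.Perm U)).toMeasure =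
      jaccard A B * (1 - jaccard A B) := by
  have hsq : mhInd hA hB ^ 2 = mhInd hA hB := by
    funext π
    simp only [Pi.pow_apply, mhInd]
    split_ifs <;> simp
  rw [variance_eq_sub (mh_memLp hA hB), hsq, mh_integral]
  ring

lemma mh_var_main {U : Type*} [Fintype U] [LinearOrder U] {A B : Finset U} (hA : A.Nonempty)
    (hB : B.Nonempty) (K : ℕ) (hK : 1 ≤ K) :
    variance (minHashEstimator hA hB K)
        (PMF.uniformOfFintype (Fin K → Equiv.Perm U)).toMeasure =
      jaccard A B * (1 - jaccard A B) / K := by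
  have e : minHashEstimator hA hB K =
      fun πs => (K : ℝ)⁻¹ * (∑ k : Fin K, fun πs : Fin K → Equiv.Perm U =>
        mhInd hA hB (πs k)) πs := by
    funext πs
    simp only [minHashEstimator, Finset.sum_apply, mhInd, Finset.sum_boole]
    ring
  have hK' : (K : ℝ) ≠ 0 := by positivity
  rw [e, variance_const_mul, mh_pi, variance_sum_pi fun _ => mh_memLp hA hB]
  simp only [mh_var, Finset.sum_const, Finset.card_univ, Fintype.card_fin, nsmul_eq_mul]
  field_simp

/-- With `σ = J(A,B)`, the variance of the MinHash estimator built from `K ≥ 1`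
independent uniformly random permutations equals `σ(1-σ)/K`, hence is at most
`1/(4K)`, and the standard deviation is at most `1/(2√K)`, i.e. the expected
error of the MinHash estimate is `O(1/√K)`. -/
theorem variance_minHashEstimator {U : Type*} [Fintype U] [LinearOrder U] [Nonempty U]
    (A B : Finset U) (hA : A.Nonempty) (hB : B.Nonempty) (K : ℕ) (hK : 1 ≤ K)
    (σ : ℝ) (hσ : σ = jaccard A B) :
    ProbabilityTheory.variance (minHashEstimator hA hB K)
        (PMF.uniformOfFintype (Fin K → Equiv.Perm U)).toMeasure
      = σ * (1 - σ) / K ∧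
    ProbabilityTheory.variance (minHashEstimator hA hB K)
        (PMF.uniformOfFintype (Fin K → Equiv.Perm U)).toMeasure
      ≤ 1 / (4 * K) ∧
    Real.sqrt (ProbabilityTheory.variance (minHashEstimator hA hB K)
        (PMF.uniformOfFintype (Fin K → Equiv.Perm U)).toMeasure)
      ≤ 1 / (2 * Real.sqrt K) := by
  have h := mh_var_main hA hB K hK
  rw [← hσ] at h
  have hKpos : (0 : ℝ) < K := by exact_mod_cast hK
  have h2 : σ * (1 - σ) / K ≤ 1 / (4 * K) := by
    rw [div_le_div_iff₀ hKpos (by positivity)]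
    nlinarith [mul_nonneg hKpos.le (sq_nonneg (2 * σ - 1))]
  rw [h]
  refine ⟨rfl, h2, ?_⟩
  refine (Real.sqrt_le_sqrt h2).trans (le_of_eq ?_)
  rw [Real.sqrt_div zero_le_one, Real.sqrt_one, Real.sqrt_mul (by norm_num)]
  congr 2
  rw [show (4 : ℝ) = 2 ^ 2 by norm_num, Real.sqrt_sq (by norm_num)]
end

section
/- Let U be a nonempty finite linear order, let A, B be nonempty finite subsets of U with σ = J(A,B), and let π₁, …, π_K be K ≥ 1 independent uniformly distributed permutations of U. Then the agreement count X = #{k : min π_k(A) = min π_k(B)} is distributed as a Binomial(K, σ) random variable, and consequently, for every θ ≥ 0, Pr[σ − θ ≤ X/K ≤ σ + θ] = p(K,σ,θ) := Σ_{t ∈ ℕ, K(σ−θ) ≤ t ≤ K(σ+θ)} C(K,t) σ^t (1−σ)^{K−t}. -/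
open scoped ENNReal

/-- The agreement count: the number of indices `k` for which the minimum of
`πs k '' A` equals the minimum of `πs k '' B`. -/
def agreeCount {U : Type*} [Fintype U] [LinearOrder U]
    {A B : Finset U} (hA : A.Nonempty) (hB : B.Nonempty) (K : ℕ)
    (πs : Fin K → Equiv.Perm U) : ℕ :=
  (Finset.univ.filter fun k : Fin K =>
      (A.image (πs k)).min' (hA.image (πs k)) =
        (B.image (πs k)).min' (hB.image (πs k))).card

/-- `p(K,σ,θ) = Σ_{t ∈ ℕ, K(σ−θ) ≤ t ≤ K(σ+θ)} C(K,t) σ^t (1−σ)^{K−t}`,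
the probability that a `Binomial(K,σ)` variable scaled by `1/K` lies in `[σ−θ, σ+θ]`. -/
noncomputable def pApprox (K : ℕ) (σ θ : ℝ) : ℝ :=
  ∑' t : ℕ, if (K : ℝ) * (σ - θ) ≤ (t : ℝ) ∧ (t : ℝ) ≤ (K : ℝ) * (σ + θ)
    then (K.choose t : ℝ) * σ ^ t * (1 - σ) ^ (K - t) else 0

/-- The permutations for which `x` attains the minimum over `S`. -/
noncomputable def minAt {U : Type*} [Fintype U] [LinearOrder U] (S : Finset U) (x : U) :
    Finset (Equiv.Perm U) := by
  classical exact Finset.univ.filter fun π => ∀ y ∈ S, π x ≤ π y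

theorem mem_minAt {U : Type*} [Fintype U] [LinearOrder U] (S : Finset U) (x : U)
    (π : Equiv.Perm U) : π ∈ minAt S x ↔ ∀ y ∈ S, π x ≤ π y := by
  simp [minAt]

theorem card_minAt_le {U : Type*} [Fintype U] [LinearOrder U] (S : Finset U) (x x' : U)
    (hx : x ∈ S) (hx' : x' ∈ S) : (minAt S x).card ≤ (minAt S x').card := by
  classical
  refine Finset.card_le_card_of_injOn (fun π => π * Equiv.swap x x') ?_ ?_
  · intro π hπ
    have hπ := (mem_minAt S x π).1 hπ
    refine (mem_minAt S x' _).2 ?_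
    intro y hy
    simp only [Equiv.Perm.mul_apply, Equiv.swap_apply_right]
    apply hπ
    rw [Equiv.swap_apply_def]
    split_ifs <;> assumption
  · intro a _ b _ h
    exact mul_right_cancel h

theorem minAt_disjoint {U : Type*} [Fintype U] [LinearOrder U] (S T : Finset U) (hT : T ⊆ S) :
    (T : Set U).PairwiseDisjoint (minAt S) := by
  intro x hx y hy hxy
  rw [Function.onFun, Finset.disjoint_left]
  intro π h1 h2
  rw [mem_minAt] at h1 h2
  exact hxy (π.injective (le_antisymm (h1 y (hT hy)) (h2 x (hT hx))))

theorem card_biUnion_minAt {U : Type*} [Fintype U] [LinearOrder U] (S T : Finset U) (hT : T ⊆ S)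
    (x0 : U) (hx0 : x0 ∈ S) :
    (T.biUnion (minAt S)).card = T.card * (minAt S x0).card := by
  rw [Finset.card_biUnion (minAt_disjoint S T hT)]
  rw [Finset.sum_congr rfl (fun x hx => le_antisymm (card_minAt_le S x x0 (hT hx) hx0)
    (card_minAt_le S x0 x hx0 (hT hx)))]
  simp

/-- The set of permutations on which the two minima agree. -/
def goodPerms {U : Type*} [Fintype U] [LinearOrder U]
    {A B : Finset U} (hA : A.Nonempty) (hB : B.Nonempty) : Finset (Equiv.Perm U) :=
  Finset.univ.filter fun π => (A.image π).min' (hA.image π) = (B.image π).min' (hB.image π)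

theorem goodPerms_eq {U : Type*} [Fintype U] [LinearOrder U]
    {A B : Finset U} (hA : A.Nonempty) (hB : B.Nonempty) :
    goodPerms hA hB = (A ∩ B).biUnion (minAt (A ∪ B)) := by
  ext π
  simp only [goodPerms, Finset.mem_filter, Finset.mem_univ, true_and, Finset.mem_biUnion,
    mem_minAt]
  constructor
  · intro h
    obtain ⟨a, ha, hae⟩ := Finset.mem_image.1 ((A.image π).min'_mem (hA.image π))
    obtain ⟨b, hb, hbe⟩ := Finset.mem_image.1 ((B.image π).min'_mem (hB.image π))
    have hab : a = b := π.injective (by rw [hae, hbe, h])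
    subst hab
    refine ⟨a, Finset.mem_inter.2 ⟨ha, hb⟩, fun y hy => ?_⟩
    rcases Finset.mem_union.1 hy with hy | hy
    · rw [hae]; exact Finset.min'_le _ _ (Finset.mem_image_of_mem _ hy)
    · rw [hbe]; exact Finset.min'_le _ _ (Finset.mem_image_of_mem _ hy)
  · rintro ⟨x, hx, h⟩
    have key : ∀ (C : Finset U) (hC : C.Nonempty), x ∈ C → C ⊆ A ∪ B →
        (C.image π).min' (hC.image π) = π x := by
      intro C hC hxC hCS
      refine le_antisymm (Finset.min'_le _ _ (Finset.mem_image_of_mem _ hxC)) ?_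
      refine Finset.le_min' _ _ _ ?_
      intro y hy
      obtain ⟨z, hz, rfl⟩ := Finset.mem_image.1 hy
      exact h z (hCS hz)
    rw [Finset.mem_inter] at hx
    rw [key A hA hx.1 Finset.subset_union_left, key B hB hx.2 Finset.subset_union_right]

theorem univ_eq_biUnion {U : Type*} [Fintype U] [LinearOrder U]
    (S : Finset U) (hS : S.Nonempty) : (Finset.univ : Finset (Equiv.Perm U)) =
      S.biUnion (minAt S) := by
  symm
  rw [Finset.eq_univ_iff_forall]
  intro π
  obtain ⟨x, hx, h⟩ := S.exists_min_image π hS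
  exact Finset.mem_biUnion.2 ⟨x, hx, (mem_minAt S x π).2 h⟩

theorem goodPerms_card {U : Type*} [Fintype U] [LinearOrder U]
    {A B : Finset U} (hA : A.Nonempty) (hB : B.Nonempty) :
    ((goodPerms hA hB).card : ℝ) = jaccard A B * (Fintype.card (Equiv.Perm U) : ℝ) := by
  have hA' := hA
  have hx : hA.choose ∈ A := hA.choose_spec
  generalize hA.choose = x at hx
  have hx' : x ∈ A ∪ B := Finset.mem_union_left _ hx
  have h1 := card_biUnion_minAt (A ∪ B) (A ∩ B)
    (Finset.inter_subset_left.trans Finset.subset_union_left) x hx'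
  have h2 := card_biUnion_minAt (A ∪ B) (A ∪ B) subset_rfl x hx'
  rw [← univ_eq_biUnion _ ⟨x, hx'⟩, Finset.card_univ] at h2
  have h3 : ((A ∪ B).card : ℝ) ≠ 0 := by
    exact_mod_cast (Finset.card_pos.2 ⟨x, hx'⟩).ne'
  rw [goodPerms_eq hA' hB, h1, h2, jaccard]
  push_cast
  field_simp

theorem count_eq {P : Type*} [Fintype P] [DecidableEq P] (G : Finset P) (K t : ℕ) :
    (Finset.univ.filter fun f : Fin K → P =>
      (Finset.univ.filter fun k => f k ∈ G).card = t).card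
      = K.choose t * G.card ^ t * (Gᶜ).card ^ (K - t) := by
  have h : (Finset.univ.filter fun f : Fin K → P =>
      (Finset.univ.filter fun k => f k ∈ G).card = t)
      = (Finset.powersetCard t (Finset.univ : Finset (Fin K))).biUnion
        (fun s => Fintype.piFinset fun k => if k ∈ s then G else Gᶜ) := by
    ext f
    simp only [Finset.mem_filter, Finset.mem_univ, true_and, Finset.mem_biUnion,
      Finset.mem_powersetCard, Finset.subset_univ, Fintype.mem_piFinset]
    constructor
    · intro h
      refine ⟨_, h, fun k => ?_⟩
      by_cases hk : f k ∈ G <;> simp [hk]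
    · rintro ⟨s, hs, h⟩
      rw [← hs]
      congr 1
      ext k
      have := h k
      by_cases hk : k ∈ s <;> simp_all
  rw [h, Finset.card_biUnion]
  · have : ∀ s ∈ Finset.powersetCard t (Finset.univ : Finset (Fin K)),
        (Fintype.piFinset fun k => if k ∈ s then G else Gᶜ).card
          = G.card ^ t * (Gᶜ).card ^ (K - t) := by
      intro s hs
      rw [Finset.mem_powersetCard] at hs
      rw [Fintype.card_piFinset]
      simp only [apply_ite Finset.card]
      rw [Finset.prod_ite]
      have h1 : (Finset.univ.filter fun k => k ∈ s) = s := by ext; simp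
      have h2 : (Finset.univ.filter fun k => k ∉ s) = sᶜ := by ext; simp
      rw [Finset.prod_const, Finset.prod_const, h1, h2, Finset.card_compl s, hs.2,
        Fintype.card_fin]
    rw [Finset.sum_congr rfl this]
    simp [mul_assoc]
  · intro s _ s' _ hne
    rw [Function.onFun, Finset.disjoint_left]
    intro f h1 h2
    apply hne
    rw [Fintype.mem_piFinset] at h1 h2
    ext k
    have a := h1 k
    have b := h2 k
    by_cases hk : k ∈ s <;> by_cases hk' : k ∈ s' <;> simp_all

instance discretePerm {α : Type*} : DiscreteMeasurableSpace (Equiv.Perm α) :=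
  ⟨fun _ => trivial⟩

theorem jaccard_mem {U : Type*} [DecidableEq U] (A B : Finset U) :
    0 ≤ jaccard A B ∧ jaccard A B ≤ 1 := by
  unfold jaccard
  refine ⟨by positivity, div_le_one_of_le₀ ?_ (by positivity)⟩
  exact_mod_cast Finset.card_le_card (Finset.inter_subset_left.trans Finset.subset_union_left)

theorem agree_prob {U : Type*} [Fintype U] [LinearOrder U]
    (A B : Finset U) (hA : A.Nonempty) (hB : B.Nonempty) (K t : ℕ) :
    (PMF.uniformOfFintype (Fin K → Equiv.Perm U)).toMeasure
          {πs : Fin K → Equiv.Perm U | agreeCount hA hB K πs = t}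
        = ENNReal.ofReal ((K.choose t : ℝ) * jaccard A B ^ t * (1 - jaccard A B) ^ (K - t)) := by
  classical
  rw [PMF.toMeasure_uniformOfFintype_apply _ (Set.toFinite _).measurableSet]
  have hc : Fintype.card {πs : Fin K → Equiv.Perm U | agreeCount hA hB K πs = t}
      = K.choose t * (goodPerms hA hB).card ^ t * ((goodPerms hA hB)ᶜ).card ^ (K - t) := by
    rw [← count_eq, ← Set.toFinset_card]
    congr 1
    ext f
    rw [Set.mem_toFinset]
    simp [agreeCount, goodPerms]
  have hN : (0 : ℝ) < Fintype.card (Equiv.Perm U) := by exact_mod_cast Fintype.card_pos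
  have hg := goodPerms_card hA hB
  have hg' : (((goodPerms hA hB)ᶜ).card : ℝ)
      = (1 - jaccard A B) * Fintype.card (Equiv.Perm U) := by
    rw [Finset.card_compl, Nat.cast_sub (Finset.card_le_univ _), hg]; ring
  have hM : (0 : ℝ) < Fintype.card (Fin K → Equiv.Perm U) := by exact_mod_cast Fintype.card_pos
  rw [hc, ← ENNReal.ofReal_natCast, ← ENNReal.ofReal_natCast (Fintype.card (Fin K → _)),
    ← ENNReal.ofReal_div_of_pos hM]
  congr 1
  rw [div_eq_iff hM.ne']
  push_cast
  rw [hg, hg', Fintype.card_fun, Fintype.card_fin]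
  push_cast
  by_cases htK : t ≤ K
  · obtain ⟨d, rfl⟩ := Nat.exists_eq_add_of_le htK
    rw [Nat.add_sub_cancel_left, mul_pow, mul_pow, pow_add]
    ring
  · rw [Nat.choose_eq_zero_of_lt (not_le.1 htK)]; simp

/-- The agreement count `X` of the MinHash estimator built from `K ≥ 1` independent
uniformly random permutations is distributed as `Binomial(K, σ)` with `σ = J(A,B)`;
consequently, for every `θ ≥ 0`, `Pr[σ − θ ≤ X/K ≤ σ + θ] = p(K,σ,θ)`. -/
theorem agreeCount_binomial {U : Type*} [Fintype U] [LinearOrder U] [Nonempty U]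
    (A B : Finset U) (hA : A.Nonempty) (hB : B.Nonempty) (K : ℕ) (hK : 1 ≤ K)
    (σ : ℝ) (hσ : σ = jaccard A B) :
    (∀ t : ℕ,
      (PMF.uniformOfFintype (Fin K → Equiv.Perm U)).toMeasure
          {πs : Fin K → Equiv.Perm U | agreeCount hA hB K πs = t}
        = ENNReal.ofReal ((K.choose t : ℝ) * σ ^ t * (1 - σ) ^ (K - t))) ∧
    (∀ θ : ℝ, 0 ≤ θ →
      (PMF.uniformOfFintype (Fin K → Equiv.Perm U)).toMeasure
          {πs : Fin K → Equiv.Perm U |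
            σ - θ ≤ (agreeCount hA hB K πs : ℝ) / K ∧
              (agreeCount hA hB K πs : ℝ) / K ≤ σ + θ}
        = ENNReal.ofReal (pApprox K σ θ)) := by
  subst hσ
  obtain ⟨h0, h1⟩ := jaccard_mem A B
  refine ⟨agree_prob A B hA hB K, fun θ _ => ?_⟩
  classical
  have hK' : (0 : ℝ) < K := by exact_mod_cast hK
  set σ := jaccard A B with hσ
  have hset : {πs : Fin K → Equiv.Perm U |
            σ - θ ≤ (agreeCount hA hB K πs : ℝ) / K ∧
              (agreeCount hA hB K πs : ℝ) / K ≤ σ + θ}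
      = ⋃ t ∈ (Finset.range (K + 1)).filter (fun t : ℕ => (K : ℝ) * (σ - θ) ≤ (t : ℝ) ∧
          (t : ℝ) ≤ (K : ℝ) * (σ + θ)),
        {πs : Fin K → Equiv.Perm U | agreeCount hA hB K πs = t} := by
    ext f
    have hle : agreeCount hA hB K f < K + 1 := by
      have := Finset.card_filter_le (Finset.univ : Finset (Fin K)) (fun k : Fin K =>
        (A.image (f k)).min' (hA.image (f k)) = (B.image (f k)).min' (hB.image (f k)))
      rw [Finset.card_univ, Fintype.card_fin] at this
      exact Nat.lt_succ_of_le this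
    simp only [Set.mem_ofPred_eq, Set.mem_iUnion, Finset.mem_filter, Finset.mem_range,
      exists_prop, exists_eq_right', hle, true_and, le_div_iff₀ hK', div_le_iff₀ hK',
      mul_comm (K : ℝ)]
  rw [hset, MeasureTheory.measure_biUnion_finset]
  · rw [Finset.sum_congr rfl (fun t _ => agree_prob A B hA hB K t), ← hσ,
      ← ENNReal.ofReal_sum_of_nonneg]
    · congr 1
      unfold pApprox
      rw [tsum_eq_sum (s := Finset.range (K + 1)), Finset.sum_filter]
      intro t ht
      rw [Finset.mem_range, not_lt] at ht
      rw [Nat.choose_eq_zero_of_lt ht]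
      simp
    · intro t _
      have : 0 ≤ 1 - σ := sub_nonneg.2 h1
      positivity
  · intro s _ t _ hst
    rw [Function.onFun, Set.disjoint_left]
    intro f h1 h2
    exact hst (h1.symm.trans h2)
  · intro t _
    exact (Set.toFinite _).measurableSet
end

section
/- (Sequential composition.) Let D be a type with an adjacency relation adj, let n ≥ 1, and for each i ∈ {1,…,n} let M_i : D → PMF(O) be a mechanism satisfying ε_i-differential privacy with respect to adj, where the mechanisms are applied independently to the same input. Then the combined mechanism M : D → PMF(Fin n → O), which on input x outputs the vector of independent samples (M_1(x), …, M_n(x)), satisfies (ε_1 + ⋯ + ε_n)-differential privacy with respect to adj. -/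
open scoped ENNReal

/-- A mechanism `M : D → PMF O` satisfies `ε`-differential privacy with respect to the
adjacency relation `adj` if for all adjacent inputs and every output `o`,
`(M x)(o) ≤ exp(ε) · (M y)(o)`. -/
def DiffPrivate {D O : Type*} (adj : D → D → Prop) (ε : ℝ) (M : D → PMF O) : Prop :=
  ∀ x y, adj x y → ∀ o, M x o ≤ ENNReal.ofReal (Real.exp ε) * M y o

/-- Sequential composition: if each mechanism `M i` satisfies `ε i`-differential privacy,
then the combined mechanism that independently applies all of them to the same input
(so that the probability of the output vector `o` is `∏ i, (M i x)(o i)`) satisfies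
`(∑ i, ε i)`-differential privacy. -/
theorem sequential_composition {D O : Type*} (adj : D → D → Prop)
    (n : ℕ) (hn : 1 ≤ n) (ε : Fin n → ℝ) (hε : ∀ i, 0 ≤ ε i)
    (M : Fin n → D → PMF O) (hM : ∀ i, DiffPrivate adj (ε i) (M i))
    (Mc : D → PMF (Fin n → O))
    (hMc : ∀ x (o : Fin n → O), Mc x o = ∏ i, M i x (o i)) :
    DiffPrivate adj (∑ i, ε i) Mc := by
  intro x y hxy o
  rw [hMc, hMc, Real.exp_sum, ENNReal.ofReal_prod_of_nonneg (fun i _ => (Real.exp_pos _).le),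
    ← Finset.prod_mul_distrib]
  exact Finset.prod_le_prod' (fun i _ => hM i x y hxy (o i))
end

section
/- (Exponential mechanism is differentially private.) Let D be a type with an adjacency relation adj, let Ψ be a nonempty finite set of candidate outputs, let q : D → Ψ → ℝ be a score function, and let Δq > 0 satisfy |q(x,ψ) − q(y,ψ)| ≤ Δq for all adjacent x, y and all ψ ∈ Ψ. For ε ≥ 0, let M(x) be the distribution on Ψ assigning to ψ probability exp(ε·q(x,ψ)/(2Δq)) / Σ_{ψ'∈Ψ} exp(ε·q(x,ψ')/(2Δq)). Then for all adjacent x, y and every ψ ∈ Ψ, (M x)(ψ) ≤ exp(ε) · (M y)(ψ); i.e., the exponential mechanism satisfies ε-differential privacy. -/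
open scoped ENNReal

/-- The exponential mechanism is `ε`-differentially private: if the score function `q`
has sensitivity at most `Δq` over adjacent datasets, and `M x` selects the candidate
`ψ` with probability proportional to `exp(ε·q(x,ψ)/(2Δq))`, then for all adjacent
`x, y` and every candidate `ψ`, `(M x)(ψ) ≤ exp(ε) · (M y)(ψ)`. -/
theorem exponentialMechanism_diffPrivate {D Ψ : Type*} [Fintype Ψ] [Nonempty Ψ]
    (adj : D → D → Prop) (q : D → Ψ → ℝ) (Δq : ℝ) (hΔq : 0 < Δq)
    (hsens : ∀ x y, adj x y → ∀ ψ, |q x ψ - q y ψ| ≤ Δq)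
    (ε : ℝ) (hε : 0 ≤ ε)
    (M : D → PMF Ψ)
    (hM : ∀ x ψ, M x ψ =
      ENNReal.ofReal (Real.exp (ε * q x ψ / (2 * Δq)) /
        ∑ ψ' : Ψ, Real.exp (ε * q x ψ' / (2 * Δq)))) :
    ∀ x y, adj x y → ∀ ψ, M x ψ ≤ ENNReal.ofReal (Real.exp ε) * M y ψ := by
  intro x y hxy ψ
  have key : ∀ a b : ℝ, a - b ≤ Δq →
      Real.exp (ε * a / (2 * Δq)) ≤ Real.exp (ε / 2) * Real.exp (ε * b / (2 * Δq)) := by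
    intro a b hab
    rw [← Real.exp_add, Real.exp_le_exp]
    have h2 : ε / 2 + ε * b / (2 * Δq) = ε * (Δq + b) / (2 * Δq) := by
      field_simp
    rw [h2]
    have h3 : ε * a ≤ ε * (Δq + b) := mul_le_mul_of_nonneg_left (by linarith) hε
    exact div_le_div_of_nonneg_right h3 (by positivity)
  have hpos : ∀ z, 0 < ∑ ψ' : Ψ, Real.exp (ε * q z ψ' / (2 * Δq)) := fun z =>
    Finset.sum_pos (fun i _ => Real.exp_pos _) Finset.univ_nonempty
  have hnum := key (q x ψ) (q y ψ) (abs_le.mp (hsens x y hxy ψ)).2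
  have hden : ∑ ψ' : Ψ, Real.exp (ε * q y ψ' / (2 * Δq)) ≤
      Real.exp (ε / 2) * ∑ ψ' : Ψ, Real.exp (ε * q x ψ' / (2 * Δq)) := by
    rw [Finset.mul_sum]
    refine Finset.sum_le_sum fun i _ => key _ _ ?_
    have := (abs_le.mp (hsens x y hxy i)).1
    linarith
  have he : Real.exp ε = Real.exp (ε / 2) * Real.exp (ε / 2) := by
    rw [← Real.exp_add]; congr 1; ring
  rw [hM, hM, ← ENNReal.ofReal_mul (Real.exp_pos ε).le]
  apply ENNReal.ofReal_le_ofReal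
  rw [← mul_div_assoc, div_le_div_iff₀ (hpos x) (hpos y)]
  calc _ ≤ (Real.exp (ε / 2) * Real.exp (ε * q y ψ / (2 * Δq))) *
        (Real.exp (ε / 2) * ∑ ψ' : Ψ, Real.exp (ε * q x ψ' / (2 * Δq))) :=
        mul_le_mul hnum hden (hpos y).le (by positivity)
    _ = _ := by rw [he]; ring
end

section
/- (Laplace mechanism is differentially private.) Let b > 0 and let μ_b be the Laplace measure on ℝ, i.e., the measure with density x ↦ (1/(2b))·exp(−|x|/b) with respect to Lebesgue measure. Let D be a type with an adjacency relation adj, let f : D → ℝ, and let Δ > 0 satisfy |f(x) − f(y)| ≤ Δ for all adjacent x, y. Then for all adjacent x, y and every measurable set A ⊆ ℝ, μ_b{z : f(x) + z ∈ A} ≤ exp(Δ/b) · μ_b{z : f(y) + z ∈ A}. In particular, with scale b = Δ/ε the mechanism releasing f(x) plus Laplace(Δ/ε) noise satisfies ε-differential privacy. -/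
open MeasureTheory

/-- The Laplace measure on `ℝ` with scale `b`: the measure with density
`x ↦ (1/(2b))·exp(−|x|/b)` with respect to Lebesgue measure. -/
noncomputable def laplaceMeasure (b : ℝ) : Measure ℝ :=
  volume.withDensity fun x => ENNReal.ofReal ((1 / (2 * b)) * Real.exp (-|x| / b))

/-- Change of variables: the Laplace measure of a shifted set. -/
theorem laplaceMeasure_shift (b c : ℝ) (A : Set ℝ) (hA : MeasurableSet A) :
    laplaceMeasure b {z : ℝ | c + z ∈ A} =
      ∫⁻ w in A, ENNReal.ofReal ((1 / (2 * b)) * Real.exp (-|w - c| / b)) := by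
  have hS : MeasurableSet {z : ℝ | c + z ∈ A} := (measurable_const_add c) hA
  rw [laplaceMeasure, withDensity_apply _ hS, ← lintegral_indicator hS, ← lintegral_indicator hA,
    ← lintegral_sub_right_eq_self _ c]
  congr 1
  ext w
  have h : c + (w - c) = w := by ring
  by_cases hw : w ∈ A <;> simp [Set.indicator, h, hw]

/-- The Laplace mechanism is differentially private: if `f` has sensitivity at most
`Δ` over adjacent datasets, then for all adjacent `x, y` and every measurable set
`A ⊆ ℝ`, `μ_b{z : f(x) + z ∈ A} ≤ exp(Δ/b) · μ_b{z : f(y) + z ∈ A}`. In particular,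
with scale `b = Δ/ε` the mechanism releasing `f(x)` plus `Laplace(Δ/ε)` noise
satisfies `ε`-differential privacy. -/
theorem laplaceMechanism_diffPrivate {D : Type*} (adj : D → D → Prop)
    (b : ℝ) (hb : 0 < b) (f : D → ℝ) (Δ : ℝ) (hΔ : 0 < Δ)
    (hsens : ∀ x y, adj x y → |f x - f y| ≤ Δ) :
    ∀ x y, adj x y → ∀ A : Set ℝ, MeasurableSet A →
      laplaceMeasure b {z : ℝ | f x + z ∈ A}
        ≤ ENNReal.ofReal (Real.exp (Δ / b)) * laplaceMeasure b {z : ℝ | f y + z ∈ A} := by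
  intro x y hxy A hA
  rw [laplaceMeasure_shift b _ A hA, laplaceMeasure_shift b _ A hA,
    ← lintegral_const_mul' _ _ ENNReal.ofReal_ne_top]
  refine lintegral_mono fun w => ?_
  rw [← ENNReal.ofReal_mul (Real.exp_pos _).le]
  apply ENNReal.ofReal_le_ofReal
  rw [mul_left_comm, ← Real.exp_add, ← add_div]
  have h1 := hsens x y hxy
  have h2 : |w - f y| ≤ |w - f x| + |f x - f y| := abs_sub_le _ _ _
  gcongr
  linarith
end

section
/- (Sensitivity of the PrivMin score function.) Fix N ≥ 1 and for a finite set h ⊆ ℕ with |h| = N and a candidate ψ ∈ ℕ, define d(h,ψ) = min{ |h \ h'| : h' ⊆ ℕ, |h'| = N, min h' = ψ }, the least number of elements of h that must be changed so that the minimum becomes ψ (so the score function is q(h,ψ) = −d(h,ψ)). Then for all finite sets h₁, h₂ ⊆ ℕ with |h₁| = |h₂| = N and |h₁ \ h₂| ≤ 1 (they differ in at most one element), and every ψ ∈ ℕ, |d(h₁,ψ) − d(h₂,ψ)| ≤ 1; i.e., the score function q has sensitivity Δq = 1. -/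
/-- `minChanges N h ψ` is the least number of elements of the `N`-element hash value
set `h` that must be changed so that the minimum of the resulting `N`-element set
is `ψ`; the PrivMin score function is `q(h,ψ) = −minChanges N h ψ`. -/
noncomputable def minChanges (N : ℕ) (h : Finset ℕ) (ψ : ℕ) : ℕ :=
  sInf {m : ℕ | ∃ h' : Finset ℕ,
    h'.card = N ∧ h'.min = (ψ : WithTop ℕ) ∧ (h \ h').card = m}

theorem minChanges_le_add_one (N : ℕ) (hN : 1 ≤ N) (h₁ h₂ : Finset ℕ)
    (hn : (h₁ \ h₂).card ≤ 1) (ψ : ℕ) :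
    minChanges N h₁ ψ ≤ minChanges N h₂ ψ + 1 := by
  have hne : {m : ℕ | ∃ h' : Finset ℕ,
      h'.card = N ∧ h'.min = (ψ : WithTop ℕ) ∧ (h₂ \ h').card = m}.Nonempty := by
    refine ⟨_, Finset.Ico ψ (ψ + N), by simp, ?_, rfl⟩
    apply le_antisymm
    · exact Finset.min_le (by simp; omega)
    · refine Finset.le_min fun a ha => ?_
      exact WithTop.coe_le_coe.2 (Finset.mem_Ico.1 ha).1
  obtain ⟨h', hc, hm, he⟩ := Nat.sInf_mem hne
  have h1 : minChanges N h₁ ψ ≤ (h₁ \ h').card := Nat.sInf_le ⟨h', hc, hm, rfl⟩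
  have h2 : (h₁ \ h').card ≤ (h₁ \ h₂).card + (h₂ \ h').card := by
    refine le_trans (Finset.card_le_card ?_) (Finset.card_union_le _ _)
    intro x hx
    simp only [Finset.mem_union, Finset.mem_sdiff] at hx ⊢
    tauto
  have h3 : (h₂ \ h').card = minChanges N h₂ ψ := he
  omega

/-- The PrivMin score function has sensitivity `Δq = 1`: for `N`-element hash value
sets `h₁, h₂` differing in at most one element, and every candidate `ψ`,
`|d(h₁,ψ) − d(h₂,ψ)| ≤ 1`. -/
theorem privMin_score_sensitivity (N : ℕ) (hN : 1 ≤ N)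
    (h₁ h₂ : Finset ℕ) (hc₁ : h₁.card = N) (hc₂ : h₂.card = N)
    (hneighbour : (h₁ \ h₂).card ≤ 1) :
    ∀ ψ : ℕ, |(minChanges N h₁ ψ : ℤ) - (minChanges N h₂ ψ : ℤ)| ≤ 1 := by
  intro ψ
  have hn' : (h₂ \ h₁).card ≤ 1 := by
    rw [← Finset.card_sdiff_comm (hc₁.trans hc₂.symm)]
    exact hneighbour
  have a := minChanges_le_add_one N hN h₁ h₂ hneighbour ψ
  have b := minChanges_le_add_one N hN h₂ h₁ hn' ψ
  rw [abs_le]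
  constructor <;> omega
end
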